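/- arXiv:1608.06811 — 2 statements merged into one kernel-verified Lean document; each statement's English description precedes it below -/
import Mathlib

section
/- Let S ⊆ ℤ[x]^n be an affine P[x]-semimodule, F a face of S, and u ∈ F^{md}. Then F + ℤ[x]·u := {a + g·u : a ∈ F, g ∈ ℤ[x]} is a face of S + ℤ[x]·u := {b + g·u : b ∈ S, g ∈ ℤ[x]}. -/
open Polynomial

/-- `P[x] = {f ∈ ℤ[x] : f = 0 or the leading coefficient of f is positive}`. -/
def PxSet : Set (Polynomial ℤ) := {f | f = 0 ∨ 0 < f.leadingCoeff}

/-- The affine `P[x]`-semimodule `P[x](U) = {Σ gᵢ • uᵢ : gᵢ ∈ P[x]}` generated by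
`u₁, …, u_m ∈ ℤ[x]ⁿ`. -/
def PxSpan {m n : ℕ} (u : Fin m → (Fin n → Polynomial ℤ)) : Set (Fin n → Polynomial ℤ) :=
  {s | ∃ g : Fin m → Polynomial ℤ, (∀ i, g i ∈ PxSet) ∧ s = ∑ i, g i • u i}

/-- `F` is a face of `S`: a `P[x]`-subsemimodule of `S` (containing `0`, closed under
addition and under scalar multiplication by elements of `P[x]`) such that
(1) `u₁ + u₂ ∈ F` with `u₁, u₂ ∈ S` implies `u₁, u₂ ∈ F`; and
(2) `g • u ∈ F` with `g ∈ P[x] ∖ {0}` and `u ∈ S` implies `u ∈ F`. -/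
def IsFace {n : ℕ} (S F : Set (Fin n → Polynomial ℤ)) : Prop :=
  F ⊆ S ∧ (0 : Fin n → Polynomial ℤ) ∈ F ∧
  (∀ a ∈ F, ∀ b ∈ F, a + b ∈ F) ∧
  (∀ g ∈ PxSet, ∀ a ∈ F, g • a ∈ F) ∧
  (∀ a ∈ S, ∀ b ∈ S, a + b ∈ F → a ∈ F ∧ b ∈ F) ∧
  (∀ g ∈ PxSet, g ≠ 0 → ∀ a ∈ S, g • a ∈ F → a ∈ F)

/-- The rank of a subset `F ⊆ ℤ[x]ⁿ`: the dimension over `ℚ(x)` (the fraction field of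
`ℤ[x]`) of the `ℚ(x)`-span of (the image of) `F` in `ℚ(x)ⁿ`. -/
noncomputable def rkSet {n : ℕ} (F : Set (Fin n → Polynomial ℤ)) : ℕ :=
  Module.finrank (FractionRing (Polynomial ℤ))
    (Submodule.span (FractionRing (Polynomial ℤ))
      ((fun v (j : Fin n) => algebraMap (Polynomial ℤ) (FractionRing (Polynomial ℤ)) (v j)) '' F))

theorem PxSet_add {f g : Polynomial ℤ} (hf : f ∈ PxSet) (hg : g ∈ PxSet) : f + g ∈ PxSet := by
  rcases hf with rfl | hf
  · simpa using hg
  rcases hg with rfl | hg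
  · right; simpa using hf
  right
  rcases lt_trichotomy f.degree g.degree with h | h | h
  · rwa [leadingCoeff_add_of_degree_lt h]
  · rw [leadingCoeff_add_of_degree_eq h (by omega)]
    omega
  · rwa [leadingCoeff_add_of_degree_lt' h]

theorem PxSet_mul {f g : Polynomial ℤ} (hf : f ∈ PxSet) (hg : g ∈ PxSet) : f * g ∈ PxSet := by
  rcases hf with rfl | hf
  · left; simp
  rcases hg with rfl | hg
  · left; simp
  right
  rw [leadingCoeff_mul]
  exact mul_pos hf hg

theorem PxSet_or_neg (f : Polynomial ℤ) : f ∈ PxSet ∨ -f ∈ PxSet := by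
  rcases lt_trichotomy f.leadingCoeff 0 with h | h | h
  · right; right
    rw [leadingCoeff_neg]; omega
  · left; left
    exact leadingCoeff_eq_zero.mp h
  · left; right; exact h

theorem PxSpan_add {m n : ℕ} {u : Fin m → (Fin n → Polynomial ℤ)} {a b : Fin n → Polynomial ℤ}
    (ha : a ∈ PxSpan u) (hb : b ∈ PxSpan u) : a + b ∈ PxSpan u := by
  obtain ⟨g, hg, rfl⟩ := ha
  obtain ⟨h, hh, rfl⟩ := hb
  exact ⟨fun i => g i + h i, fun i => PxSet_add (hg i) (hh i), by
    simp only [add_smul, Finset.sum_add_distrib]⟩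

theorem PxSpan_smul {m n : ℕ} {u : Fin m → (Fin n → Polynomial ℤ)} {a : Fin n → Polynomial ℤ}
    {f : Polynomial ℤ} (hf : f ∈ PxSet) (ha : a ∈ PxSpan u) : f • a ∈ PxSpan u := by
  obtain ⟨g, hg, rfl⟩ := ha
  exact ⟨fun i => f * g i, fun i => PxSet_mul hf (hg i), by
    simp only [mul_smul, Finset.smul_sum]⟩

theorem IsFace_span {n : ℕ} {S F : Set (Fin n → Polynomial ℤ)} (hF : IsFace S F)
    {w : Fin n → Polynomial ℤ} (hw : w ∈ Submodule.span (Polynomial ℤ) F) :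
    ∃ p ∈ F, ∃ q ∈ F, w + q = p := by
  obtain ⟨_, h0, hadd, hsmul, _, _⟩ := hF
  induction hw using Submodule.span_induction with
  | mem x hx => exact ⟨x, hx, 0, h0, by simp⟩
  | zero => exact ⟨0, h0, 0, h0, by simp⟩
  | add x y _ _ hx hy =>
    obtain ⟨p, hp, q, hq, rfl⟩ := hx
    obtain ⟨p', hp', q', hq', rfl⟩ := hy
    exact ⟨_, hadd _ hp _ hp', _, hadd _ hq _ hq', by abel⟩
  | smul f x _ hx =>
    obtain ⟨p, hp, q, hq, rfl⟩ := hx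
    rcases PxSet_or_neg f with hf | hf
    · exact ⟨_, hsmul f hf _ hp, _, hsmul f hf _ hq, by rw [smul_add]⟩
    · exact ⟨_, hsmul _ hf _ hq, _, hsmul _ hf _ hp, by module⟩

/-- Let `S ⊆ ℤ[x]ⁿ` be an affine `P[x]`-semimodule, `F` a face of `S`,
and `w ∈ F^{md}` (the `ℤ[x]`-submodule generated by `F`).  Then
`F + ℤ[x]·w = {a + g • w : a ∈ F, g ∈ ℤ[x]}` is a face of
`S + ℤ[x]·w = {b + g • w : b ∈ S, g ∈ ℤ[x]}`. -/
theorem statement14 (m n : ℕ) (u : Fin m → (Fin n → Polynomial ℤ))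
    (S F : Set (Fin n → Polynomial ℤ)) (hS : S = PxSpan u) (hF : IsFace S F)
    (w : Fin n → Polynomial ℤ) (hw : w ∈ Submodule.span (Polynomial ℤ) F) :
    IsFace {s | ∃ b ∈ S, ∃ g : Polynomial ℤ, s = b + g • w}
      {s | ∃ a ∈ F, ∃ g : Polynomial ℤ, s = a + g • w} := by
  have key : ∀ h : Polynomial ℤ, ∃ p ∈ F, ∃ q ∈ F, h • w + q = p := fun h =>
    IsFace_span hF (Submodule.smul_mem _ h hw)
  obtain ⟨hsub, h0, hadd, hsmul, h1, h2⟩ := hF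
  subst hS
  refine ⟨?_, ⟨0, h0, 0, by simp⟩, ?_, ?_, ?_, ?_⟩
  · rintro s ⟨a, ha, g, rfl⟩
    exact ⟨a, hsub ha, g, rfl⟩
  · rintro _ ⟨a, ha, g, rfl⟩ _ ⟨b, hb, h, rfl⟩
    exact ⟨a + b, hadd a ha b hb, g + h, by module⟩
  · rintro f hf _ ⟨a, ha, g, rfl⟩
    exact ⟨f • a, hsmul f hf a ha, f * g, by module⟩
  · rintro _ ⟨a, ha, g, rfl⟩ _ ⟨b, hb, h, rfl⟩ ⟨c, hc, k, e⟩
    obtain ⟨p, hp, q, hq, hpq⟩ := key (g + h - k)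
    have e2 : a + (b + p) = c + q := by
      rw [← hpq]
      linear_combination (norm := module) e
    have hm := h1 a ha (b + p) (PxSpan_add hb (hsub hp)) (e2 ▸ hadd c hc q hq)
    exact ⟨⟨a, hm.1, g, rfl⟩, ⟨b, (h1 b hb p (hsub hp) hm.2).1, h, rfl⟩⟩
  · rintro f hf hf0 _ ⟨a, ha, g, rfl⟩ ⟨c, hc, k, e⟩
    obtain ⟨p, hp, q, hq, hpq⟩ := key (f * g - k)
    have e2 : f • a + p = c + q := by
      rw [← hpq]
      linear_combination (norm := module) e
    have hm := h1 (f • a) (PxSpan_smul hf ha) p (hsub hp) (e2 ▸ hadd c hc q hq)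
    exact ⟨a, h2 f hf hf0 a ha hm.1, g, rfl⟩
end

section
/- Let S ⊆ ℤ[x]^n be an affine P[x]-semimodule and M = S^{md} the ℤ[x]-module generated by S. A subset F ⊆ S is a proper face of S (a face with F ≠ S) if and only if there exists a nonzero ℤ[x]-module homomorphism φ : M → ℤ[x] such that φ(u) ∈ P[x] for all u ∈ S and F = {u ∈ S : φ(u) = 0}. -/
open Polynomial

/-- Farkas' lemma over a linearly ordered commutative ring. -/
theorem farkas_aux {R : Type*} [CommRing R] [LinearOrder R] [IsStrictOrderedRing R]
    {n : ℕ} {ι : Type*} [DecidableEq ι] (s : Finset ι) :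
    ∀ (a : ι → Fin n → R) (b : Fin n → R),
      (∀ x : Fin n → R, (∀ i ∈ s, 0 ≤ a i ⬝ᵥ x) → 0 ≤ b ⬝ᵥ x) →
      ∃ (d : R) (c : ι → R), 0 < d ∧ (∀ i, 0 ≤ c i) ∧ d • b = ∑ i ∈ s, c i • a i := by
  induction s using Finset.induction_on with
  | empty =>
    intro a b h
    refine ⟨1, 0, one_pos, fun _ => le_rfl, ?_⟩
    ext k
    have h1 := h (Pi.single k 1) (by simp)
    have h2 := h (Pi.single k (-1)) (by simp)
    simp at h1 h2
    simpa using le_antisymm h2 h1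
  | insert p s hp ih =>
    intro a b h
    by_cases hb : ∀ x : Fin n → R, (∀ i ∈ s, 0 ≤ a i ⬝ᵥ x) → 0 ≤ b ⬝ᵥ x
    · obtain ⟨d, c, hd, hc, e⟩ := ih a b hb
      refine ⟨d, fun i => if i = p then 0 else c i, hd, ?_, ?_⟩
      · intro i
        dsimp only
        split_ifs
        · exact le_rfl
        · exact hc i
      · rw [Finset.sum_insert hp, e]
        simp only [if_true, zero_smul, zero_add]
        refine Finset.sum_congr rfl fun i hi => ?_
        rw [if_neg (ne_of_mem_of_not_mem hi hp)]
    · push Not at hb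
      obtain ⟨y, hy, hby⟩ := hb
      have hpy : a p ⬝ᵥ y < 0 := by
        by_contra hcon
        push Not at hcon
        refine absurd (h y ?_) (not_le.mpr hby)
        intro i hi
        rcases Finset.mem_insert.mp hi with rfl | hi
        · exact hcon
        · exact hy i hi
      obtain ⟨d, c, hd, hc, e⟩ := ih
        (fun i => (-(a p ⬝ᵥ y)) • a i + (a i ⬝ᵥ y) • a p)
        ((-(a p ⬝ᵥ y)) • b + (b ⬝ᵥ y) • a p) (by
          intro x hx
          have key : ∀ w : Fin n → R, ((-(a p ⬝ᵥ y)) • w + (w ⬝ᵥ y) • a p) ⬝ᵥ x =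
              w ⬝ᵥ ((-(a p ⬝ᵥ y)) • x + (a p ⬝ᵥ x) • y) := by
            intro w
            simp only [add_dotProduct, smul_dotProduct, dotProduct_add, dotProduct_smul,
              smul_eq_mul]
            ring
          rw [key]
          apply h
          intro i hi
          rcases Finset.mem_insert.mp hi with rfl | hi
          · simp only [dotProduct_add, dotProduct_smul, smul_eq_mul]
            apply le_of_eq; ring
          · rw [← key]; exact hx i hi)
      refine ⟨d * (-(a p ⬝ᵥ y)), fun i => if i = p then
        (∑ i ∈ s, c i * (a i ⬝ᵥ y)) - d * (b ⬝ᵥ y) else c i * (-(a p ⬝ᵥ y)),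
        mul_pos hd (neg_pos.mpr hpy), ?_, ?_⟩
      · intro i
        dsimp only
        split_ifs
        · have h1 : 0 ≤ ∑ i ∈ s, c i * (a i ⬝ᵥ y) :=
            Finset.sum_nonneg fun i hi => mul_nonneg (hc i) (hy i hi)
          have h2 : d * (b ⬝ᵥ y) < 0 := mul_neg_of_pos_of_neg hd hby
          linarith
        · exact mul_nonneg (hc i) (neg_pos.mpr hpy).le
      · rw [Finset.sum_insert hp]
        have e2 : ∑ i ∈ s, (if i = p then
            (∑ i ∈ s, c i * (a i ⬝ᵥ y)) - d * (b ⬝ᵥ y) else c i * (-(a p ⬝ᵥ y))) • a i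
            = ∑ i ∈ s, (c i * (-(a p ⬝ᵥ y))) • a i :=
          Finset.sum_congr rfl fun i hi => by rw [if_neg (ne_of_mem_of_not_mem hi hp)]
        rw [e2]
        dsimp only
        rw [if_pos rfl, sub_smul, Finset.sum_smul]
        simp only [smul_add, smul_smul, Finset.sum_add_distrib] at e
        rw [sub_add_eq_add_sub, eq_sub_iff_add_eq, e, add_comm]

theorem pxSet_add {f g : ℤ[X]} (hf : f ∈ PxSet) (hg : g ∈ PxSet) : f + g ∈ PxSet := by
  rcases hf with rfl | hf
  · simpa using hg
  rcases hg with rfl | hg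
  · rw [add_zero]; exact Or.inr hf
  right
  rcases lt_trichotomy f.degree g.degree with h | h | h
  · rwa [leadingCoeff_add_of_degree_lt h]
  · rw [leadingCoeff_add_of_degree_eq h (by positivity)]
    positivity
  · rwa [leadingCoeff_add_of_degree_lt' h]

theorem pxSet_mul {f g : ℤ[X]} (hf : f ∈ PxSet) (hg : g ∈ PxSet) : f * g ∈ PxSet := by
  rcases hf with rfl | hf
  · left; simp
  rcases hg with rfl | hg
  · left; simp
  right
  rw [leadingCoeff_mul]
  positivity

theorem pxSet_zero : (0 : ℤ[X]) ∈ PxSet := Or.inl rfl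

theorem pxSet_one : (1 : ℤ[X]) ∈ PxSet := Or.inr (by simp)

theorem pxSet_antisymm {f : ℤ[X]} (hf : f ∈ PxSet) (hg : -f ∈ PxSet) : f = 0 := by
  rcases hf with hf | hf
  · exact hf
  rcases hg with hg | hg
  · simpa using hg
  · rw [leadingCoeff_neg] at hg
    omega

theorem pxSet_total (f : ℤ[X]) : f ∈ PxSet ∨ -f ∈ PxSet := by
  rcases lt_trichotomy f.leadingCoeff 0 with h | h | h
  · right; right; rw [leadingCoeff_neg]; omega
  · left; left; exact leadingCoeff_eq_zero.mp h
  · left; right; exact h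

/-- The order on `ℤ[X]`. -/
@[reducible] noncomputable def pxOrder : LinearOrder ℤ[X] where
  le f g := g - f ∈ PxSet
  le_refl f := by simpa using pxSet_zero
  le_trans f g h h1 h2 := by simpa using pxSet_add h1 h2
  le_antisymm f g h1 h2 := by
    have := pxSet_antisymm h2 (by simpa using h1)
    exact sub_eq_zero.mp this
  le_total f g := by simpa using pxSet_total (g - f)
  toDecidableLE := Classical.decRel _

attribute [local instance] pxOrder

theorem px_nonneg (f : ℤ[X]) : 0 ≤ f ↔ f ∈ PxSet := by
  change f - 0 ∈ PxSet ↔ _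
  rw [sub_zero]

theorem px_strict : IsStrictOrderedRing ℤ[X] := by
  have : IsOrderedAddMonoid ℤ[X] :=
    { add_le_add_left := fun a b h c => by
        change (b + c) - (a + c) ∈ PxSet
        rw [add_sub_add_right_eq_sub]; exact h }
  have : ZeroLEOneClass ℤ[X] := ⟨(px_nonneg _).mpr pxSet_one⟩
  refine IsStrictOrderedRing.of_mul_pos ?_
  intro a b ha hb
  refine lt_of_le_of_ne ?_ (mul_ne_zero ha.ne' hb.ne').symm
  rw [px_nonneg]
  exact pxSet_mul ((px_nonneg a).mp ha.le) ((px_nonneg b).mp hb.le)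

attribute [local instance] px_strict

theorem pxSpan_gen {m n : ℕ} (u : Fin m → (Fin n → ℤ[X])) (g : Fin m → ℤ[X])
    (hg : ∀ i, 0 ≤ g i) : ∑ i, g i • u i ∈ PxSpan u :=
  ⟨g, fun i => (px_nonneg _).mp (hg i), rfl⟩

theorem pxSpan_smul {m n : ℕ} (u : Fin m → (Fin n → ℤ[X])) (i : Fin m) (g : ℤ[X])
    (hg : 0 ≤ g) : g • u i ∈ PxSpan u := by
  classical
  refine ⟨Pi.single i g, fun j => ?_, ?_⟩
  · rw [← px_nonneg]
    by_cases h : j = i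
    · subst h; simpa using hg
    · simp [h]
  · simp [Pi.single_apply, ite_smul]

theorem pxSpan_add {m n : ℕ} (u : Fin m → (Fin n → ℤ[X])) {v w : Fin n → ℤ[X]}
    (hv : v ∈ PxSpan u) (hw : w ∈ PxSpan u) : v + w ∈ PxSpan u := by
  obtain ⟨g, hg, rfl⟩ := hv
  obtain ⟨h, hh, rfl⟩ := hw
  exact ⟨fun i => g i + h i, fun i => pxSet_add (hg i) (hh i), by
    simp [add_smul, Finset.sum_add_distrib]⟩

theorem pxSpan_smul' {m n : ℕ} (u : Fin m → (Fin n → ℤ[X])) {v : Fin n → ℤ[X]} {f : ℤ[X]}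
    (hf : f ∈ PxSet) (hv : v ∈ PxSpan u) : f • v ∈ PxSpan u := by
  obtain ⟨g, hg, rfl⟩ := hv
  exact ⟨fun i => f * g i, fun i => pxSet_mul hf (hg i), by
    simp [mul_smul, Finset.smul_sum]⟩

theorem face_sum {n : ℕ} {S F : Set (Fin n → ℤ[X])} (hF : IsFace S F) {ι : Type*}
    (s : Finset ι) (w : ι → Fin n → ℤ[X]) (hw : ∀ i ∈ s, w i ∈ F) : ∑ i ∈ s, w i ∈ F := by
  classical
  induction s using Finset.induction_on with
  | empty => simpa using hF.2.1
  | insert p s hp ih =>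
    rw [Finset.sum_insert hp]
    exact hF.2.2.1 _ (hw _ (by simp)) _ (ih fun i hi => hw i (by simp [hi]))

/-- The separating functional for one generator outside the face. -/
theorem sep_one {m n : ℕ} (u : Fin m → (Fin n → ℤ[X])) (F : Set (Fin n → ℤ[X]))
    (hF : IsFace (PxSpan u) F) (j : Fin m) (hj : u j ∉ F) :
    ∃ x : Fin n → ℤ[X], (∀ i, 0 ≤ u i ⬝ᵥ x) ∧ (∀ i, u i ∈ F → u i ⬝ᵥ x = 0) ∧
      0 < u j ⬝ᵥ x := by
  classical
  let I : Finset (Fin m) := Finset.univ.filter fun i => u i ∈ F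
  let a : Option (Fin m) → Fin n → ℤ[X] := fun o => o.elim (-∑ i ∈ I, u i) u
  by_cases h : ∀ x : Fin n → ℤ[X], (∀ i ∈ (Finset.univ : Finset (Option (Fin m))),
      0 ≤ a i ⬝ᵥ x) → 0 ≤ (-u j) ⬝ᵥ x
  · exfalso
    obtain ⟨d, c, hd, hc, e⟩ := farkas_aux Finset.univ a (-u j) h
    rw [Fintype.sum_option] at e
    simp only [a, Option.elim] at e
    have e' : d • u j + ∑ i, c (some i) • u i = ∑ i ∈ I, c none • u i := by
      rw [← Finset.smul_sum]
      rw [smul_neg, smul_neg] at e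
      linear_combination -e
    have hmem : ∑ i ∈ I, c none • u i ∈ F := by
      refine face_sum hF I _ fun i hi => ?_
      exact hF.2.2.2.1 _ ((px_nonneg _).mp (hc none)) _ (Finset.mem_filter.mp hi).2
    rw [← e'] at hmem
    have h1 := (hF.2.2.2.2.1 _ (pxSpan_smul u j d hd.le) _
      (pxSpan_gen u (fun i => c (some i)) fun i => hc _) hmem).1
    refine hj (hF.2.2.2.2.2 d ((px_nonneg _).mp hd.le) hd.ne' (u j) ?_ h1)
    simpa using pxSpan_smul u j 1 zero_le_one
  · push Not at h
    obtain ⟨x, hx, hlt⟩ := h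
    have hx1 : ∀ i, 0 ≤ u i ⬝ᵥ x := fun i => hx (some i) (Finset.mem_univ _)
    have hx2 : 0 ≤ (-∑ i ∈ I, u i) ⬝ᵥ x := hx none (Finset.mem_univ _)
    refine ⟨x, hx1, ?_, ?_⟩
    · intro i hi
      rw [neg_dotProduct, sum_dotProduct] at hx2
      have h0 : ∑ i ∈ I, u i ⬝ᵥ x = 0 :=
        le_antisymm (by linarith) (Finset.sum_nonneg fun i _ => hx1 i)
      exact (Finset.sum_eq_zero_iff_of_nonneg fun i _ => hx1 i).mp h0 i
        (Finset.mem_filter.mpr ⟨Finset.mem_univ _, hi⟩)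
    · rw [neg_dotProduct] at hlt
      linarith

theorem sep_all {m n : ℕ} (u : Fin m → (Fin n → ℤ[X])) (F : Set (Fin n → ℤ[X]))
    (hF : IsFace (PxSpan u) F) :
    ∃ x : Fin n → ℤ[X], (∀ i, 0 ≤ u i ⬝ᵥ x) ∧ (∀ i, u i ∈ F ↔ u i ⬝ᵥ x = 0) := by
  classical
  choose! x hx1 hx2 hx3 using sep_one u F hF
  refine ⟨∑ j ∈ Finset.univ.filter fun j => u j ∉ F, x j, ?_, ?_⟩
  · intro i
    rw [dotProduct_sum]
    exact Finset.sum_nonneg fun j hj => hx1 j (Finset.mem_filter.mp hj).2 i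
  · intro i
    rw [dotProduct_sum]
    constructor
    · intro hi
      exact Finset.sum_eq_zero fun j hj => hx2 j (Finset.mem_filter.mp hj).2 i hi
    · intro h0
      by_contra hi
      have := (Finset.sum_eq_zero_iff_of_nonneg fun j hj =>
        hx1 j (Finset.mem_filter.mp hj).2 i).mp h0 i
          (Finset.mem_filter.mpr ⟨Finset.mem_univ _, hi⟩)
      exact (hx3 i hi).ne' this

/-- Let `S ⊆ ℤ[x]ⁿ` be an affine `P[x]`-semimodule and `M = S^{md}` the
`ℤ[x]`-module generated by `S`.  A subset `F ⊆ S` is a proper face of `S` if and only if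
there is a nonzero `ℤ[x]`-linear map `φ : M → ℤ[x]` with `φ(u) ∈ P[x]` for all `u ∈ S` and
`F = {u ∈ S : φ(u) = 0}`. -/
theorem statement15 (m n : ℕ) (u : Fin m → (Fin n → Polynomial ℤ))
    (S F : Set (Fin n → Polynomial ℤ)) (hS : S = PxSpan u) (hFS : F ⊆ S) :
    (IsFace S F ∧ F ≠ S) ↔
    ∃ φ : Submodule.span (Polynomial ℤ) S →ₗ[Polynomial ℤ] Polynomial ℤ, φ ≠ 0 ∧
      (∀ v : Submodule.span (Polynomial ℤ) S, (v : Fin n → Polynomial ℤ) ∈ S → φ v ∈ PxSet) ∧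
      F = {v | ∃ h : v ∈ S, φ ⟨v, Submodule.subset_span h⟩ = 0} := by
  classical
  subst hS
  constructor
  · rintro ⟨hF, hne⟩
    obtain ⟨x, hx1, hx2⟩ := sep_all u F hF
    let ψ : (Fin n → ℤ[X]) →ₗ[ℤ[X]] ℤ[X] :=
      { toFun := fun v => v ⬝ᵥ x
        map_add' := fun v w => add_dotProduct v w x
        map_smul' := fun c v => smul_dotProduct c v x }
    have hψ : ∀ g : Fin m → ℤ[X], ψ (∑ i, g i • u i) = ∑ i, g i * (u i ⬝ᵥ x) := by
      intro g
      rw [map_sum]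
      exact Finset.sum_congr rfl fun i _ => by rw [map_smul]; rfl
    have hker : ∀ v ∈ PxSpan u, (v ∈ F ↔ ψ v = 0) := by
      rintro v ⟨g, hg, rfl⟩
      have hterm : ∀ i ∈ Finset.univ, 0 ≤ g i * (u i ⬝ᵥ x) := fun i _ =>
        mul_nonneg ((px_nonneg _).mpr (hg i)) (hx1 i)
      rw [hψ, Finset.sum_eq_zero_iff_of_nonneg hterm]
      constructor
      · intro hv i _
        by_cases h0 : g i = 0
        · simp [h0]
        rw [← Finset.add_sum_erase _ _ (Finset.mem_univ i)] at hv
        have hrest : ∑ k ∈ Finset.univ.erase i, g k • u k ∈ PxSpan u := by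
          have := pxSpan_gen u (fun k => if k = i then 0 else g k) (fun k => by
            split_ifs
            · exact le_rfl
            · exact (px_nonneg _).mpr (hg k))
          rw [← Finset.add_sum_erase _ _ (Finset.mem_univ i)] at this
          simp only [if_true, zero_smul, zero_add] at this
          convert this using 1
          refine Finset.sum_congr rfl fun k hk => ?_
          rw [if_neg (Finset.ne_of_mem_erase hk)]
        have h1 := (hF.2.2.2.2.1 _ (pxSpan_smul u i (g i) ((px_nonneg _).mpr (hg i))) _
          hrest hv).1
        have h2 := hF.2.2.2.2.2 (g i) (hg i) h0 (u i)
          (by simpa using pxSpan_smul u i 1 zero_le_one) h1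
        rw [(hx2 i).mp h2, mul_zero]
      · intro h
        refine face_sum hF _ _ fun i hi => ?_
        rcases mul_eq_zero.mp (h i hi) with h0 | h0
        · rw [h0, zero_smul]; exact hF.2.1
        · exact hF.2.2.2.1 _ (hg i) _ ((hx2 i).mpr h0)
    refine ⟨ψ.comp (Submodule.subtype _), ?_, ?_, ?_⟩
    · intro h0
      apply hne
      refine Set.Subset.antisymm hFS fun v hv => ?_
      rw [hker v hv]
      exact LinearMap.congr_fun h0 ⟨v, Submodule.subset_span hv⟩
    · rintro ⟨v, hv'⟩ ⟨g, hg, hv⟩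
      simp only at hv
      subst hv
      change ψ (∑ i, g i • u i) ∈ PxSet
      rw [hψ, ← px_nonneg]
      exact Finset.sum_nonneg fun i _ => mul_nonneg ((px_nonneg _).mpr (hg i)) (hx1 i)
    · ext v
      constructor
      · intro hv
        exact ⟨hFS hv, (hker v (hFS hv)).mp hv⟩
      · rintro ⟨hv, h0⟩
        exact (hker v hv).mpr h0
  · rintro ⟨φ, hφ, hpos, hFeq⟩
    have h0S : (0 : Fin n → ℤ[X]) ∈ PxSpan u := by
      simpa using pxSpan_gen u 0 fun _ => le_rfl
    refine ⟨⟨hFS, ?_, ?_, ?_, ?_, ?_⟩, ?_⟩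
    · rw [hFeq]
      exact ⟨h0S, map_zero φ⟩
    · rw [hFeq]
      rintro a ⟨ha, ha0⟩ b ⟨hb, hb0⟩
      refine ⟨pxSpan_add u ha hb, ?_⟩
      have := LinearMap.map_add φ ⟨a, Submodule.subset_span ha⟩ ⟨b, Submodule.subset_span hb⟩
      rw [ha0, hb0, add_zero] at this
      exact this
    · rw [hFeq]
      rintro g hg a ⟨ha, ha0⟩
      refine ⟨pxSpan_smul' u hg ha, ?_⟩
      have := LinearMap.map_smul φ g ⟨a, Submodule.subset_span ha⟩
      rw [ha0, smul_zero] at this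
      exact this
    · intro a ha b hb hab
      rw [hFeq] at hab ⊢
      obtain ⟨hab, h0⟩ := hab
      have h1 : φ ⟨a, Submodule.subset_span ha⟩ + φ ⟨b, Submodule.subset_span hb⟩ = 0 :=
        (LinearMap.map_add φ ⟨a, Submodule.subset_span ha⟩ ⟨b, Submodule.subset_span hb⟩).symm.trans h0
      have pa := (px_nonneg _).mpr (hpos ⟨a, Submodule.subset_span ha⟩ ha)
      have pb := (px_nonneg _).mpr (hpos ⟨b, Submodule.subset_span hb⟩ hb)
      exact ⟨⟨ha, le_antisymm (by linarith) pa⟩, ⟨hb, le_antisymm (by linarith) pb⟩⟩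
    · intro g hg hg0 a ha hga
      rw [hFeq] at hga ⊢
      obtain ⟨hga, h0⟩ := hga
      have h1 : g * φ ⟨a, Submodule.subset_span ha⟩ = 0 := by
        rw [← smul_eq_mul, ← LinearMap.map_smul]
        exact h0
      exact ⟨ha, (mul_eq_zero.mp h1).resolve_left hg0⟩
    · intro hEq
      apply hφ
      refine LinearMap.ext fun v => ?_
      obtain ⟨v, hv⟩ := v
      change φ ⟨v, hv⟩ = 0
      induction hv using Submodule.span_induction with
      | mem x hx =>
        have hx' := hx
        rw [← hEq, hFeq] at hx'
        exact hx'.2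
      | zero => exact map_zero φ
      | add x y hx hy h1 h2 =>
        have := LinearMap.map_add φ ⟨x, hx⟩ ⟨y, hy⟩
        rw [h1, h2, add_zero] at this
        exact this
      | smul c x hx h1 =>
        have := LinearMap.map_smul φ c ⟨x, hx⟩
        rw [h1, smul_zero] at this
        exact this
end
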